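/- arXiv:0901.3246 — 3 statements merged into one kernel-verified Lean document; each statement's English description precedes it below -/
import Mathlib

section
/- Let W be a real random variable with E[W] = μ, Var(W) = σ² > 0, and suppose there exists d ≥ 0 such that for all s ≥ 0, | log E[exp(s(W−μ))] − (s²/2) σ² | ≤ s³ d. Then for every ε > 0, P( W − μ ≥ ε ) ≤ exp( − ε² / ( 2 ( σ² + 2 d ε / σ² ) ) ), and likewise P( W − μ ≤ −ε ) ≤ exp( − ε² / ( 2 ( σ² + 2 d ε / σ² ) ) ) if the same log-Laplace bound also holds for −(W−μ). -/
open MeasureTheory ProbabilityTheory Filter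

noncomputable section

/-- Exponential Markov inequality, with the moment generating function bounded through its
extended logarithm. -/
theorem measure_ge_le_of_log_lintegral_exp_le {Ω : Type*} [MeasurableSpace Ω] (μ : Measure Ω)
    {X : Ω → ℝ} (hX : Measurable X) {s c : ℝ} (hs : 0 ≤ s) (ε : ℝ)
    (h : ENNReal.log (∫⁻ ω, ENNReal.ofReal (Real.exp (s * X ω)) ∂μ) ≤ (c : EReal)) :
    μ {ω | ε ≤ X ω} ≤ ENNReal.ofReal (Real.exp (c - s * ε)) := by
  have hmgf : ∫⁻ ω, ENNReal.ofReal (Real.exp (s * X ω)) ∂μ ≤ ENNReal.ofReal (Real.exp c) := by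
    rw [← EReal.exp_coe, ← ENNReal.log_le_log_iff, EReal.log_exp]
    exact h
  calc μ {ω | ε ≤ X ω}
      ≤ μ {ω | ENNReal.ofReal (Real.exp (s * ε)) ≤ ENNReal.ofReal (Real.exp (s * X ω))} := by
        refine measure_mono fun ω (hω : ε ≤ X ω) => ?_
        exact ENNReal.ofReal_le_ofReal (Real.exp_le_exp.2 (mul_le_mul_of_nonneg_left hω hs))
    _ ≤ (∫⁻ ω, ENNReal.ofReal (Real.exp (s * X ω)) ∂μ) / ENNReal.ofReal (Real.exp (s * ε)) :=
        meas_ge_le_lintegral_div (by fun_prop) (by simp [Real.exp_pos]) ENNReal.ofReal_ne_top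
    _ ≤ ENNReal.ofReal (Real.exp c) / ENNReal.ofReal (Real.exp (s * ε)) := by gcongr
    _ = ENNReal.ofReal (Real.exp (c - s * ε)) := by
        rw [← ENNReal.ofReal_div_of_pos (Real.exp_pos _), Real.exp_sub]

theorem chernoff_exponent_le {v d ε : ℝ} (hv : 0 < v) (hd : 0 ≤ d) (hε : 0 < ε) :
    (ε / (v + 2 * d * ε / v)) ^ 2 / 2 * v + (ε / (v + 2 * d * ε / v)) ^ 3 * d
      - ε / (v + 2 * d * ε / v) * ε ≤ -ε ^ 2 / (2 * (v + 2 * d * ε / v)) := by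
  obtain ⟨b, hb⟩ : ∃ b, b = 2 * d * ε / v := ⟨_, rfl⟩
  have hb0 : 0 ≤ b := hb ▸ by positivity
  have hbv : b * v = 2 * d * ε := by rw [hb]; field_simp
  rw [← hb]
  have hA : 0 < v + b := by positivity
  have key : -ε ^ 2 / (2 * (v + b)) - ((ε / (v + b)) ^ 2 / 2 * v + (ε / (v + b)) ^ 3 * d
      - ε / (v + b) * ε) = ε ^ 2 * b ^ 2 / (2 * (v + b) ^ 3) := by
    field_simp
    linear_combination hbv
  have : 0 ≤ ε ^ 2 * b ^ 2 / (2 * (v + b) ^ 3) := by positivity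
  linarith

/-- Upper tail bound from a one-sided cubic log-Laplace estimate. -/
theorem measure_ge_le_of_log_laplace_le {Ω : Type*} [MeasurableSpace Ω] (μ : Measure Ω)
    {X : Ω → ℝ} (hX : Measurable X) {v d ε : ℝ} (hv : 0 < v) (hd : 0 ≤ d) (hε : 0 < ε)
    (h : ∀ s : ℝ, 0 ≤ s → ENNReal.log (∫⁻ ω, ENNReal.ofReal (Real.exp (s * X ω)) ∂μ)
      ≤ ((s ^ 2 / 2 * v + s ^ 3 * d : ℝ) : EReal)) :
    μ {ω | ε ≤ X ω} ≤ ENNReal.ofReal (Real.exp (-ε ^ 2 / (2 * (v + 2 * d * ε / v)))) := by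
  have hs : 0 ≤ ε / (v + 2 * d * ε / v) := by positivity
  exact (measure_ge_le_of_log_lintegral_exp_le μ hX hs ε (h _ hs)).trans
    (ENNReal.ofReal_le_ofReal (Real.exp_le_exp.2 (chernoff_exponent_le hv hd hε)))

/-- **Concentration from a log-Laplace estimate**. If `E W = m`, `Var W = σ² > 0` and
`|log E e^{s(W−m)} − (s²/2)σ²| ≤ s³ d` for all `s ≥ 0` (the expectation of the nonnegative
function `e^{s(W−m)}` being the lower Lebesgue integral and the logarithm the extended-real
logarithm), then `P(W − m ≥ ε) ≤ exp(−ε²/(2(σ² + 2dε/σ²)))` for every `ε > 0`; and the same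
bound holds for `P(W − m ≤ −ε)` provided the log-Laplace estimate also holds for `−(W−m)`. -/
theorem concentration_from_log_laplace
    {Ω : Type} [MeasurableSpace Ω] (μ : Measure Ω) [IsProbabilityMeasure μ]
    (W : Ω → ℝ) (hWmeas : Measurable W) (hWint : Integrable W μ)
    (m σ2 d : ℝ) (hm : ∫ ω, W ω ∂μ = m) (hσ : variance W μ = σ2) (hσpos : 0 < σ2)
    (hd : 0 ≤ d)
    (hbound : ∀ s : ℝ, 0 ≤ s →
      ((s^2 / 2 * σ2 - s^3 * d : ℝ) : EReal)
          ≤ ENNReal.log (∫⁻ ω, ENNReal.ofReal (Real.exp (s * (W ω - m))) ∂μ) ∧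
      ENNReal.log (∫⁻ ω, ENNReal.ofReal (Real.exp (s * (W ω - m))) ∂μ)
          ≤ ((s^2 / 2 * σ2 + s^3 * d : ℝ) : EReal)) :
    ∀ ε : ℝ, 0 < ε →
      μ {ω | ε ≤ W ω - m}
          ≤ ENNReal.ofReal (Real.exp (-ε^2 / (2 * (σ2 + 2 * d * ε / σ2)))) ∧
      ((∀ s : ℝ, 0 ≤ s →
          ((s^2 / 2 * σ2 - s^3 * d : ℝ) : EReal)
              ≤ ENNReal.log (∫⁻ ω, ENNReal.ofReal (Real.exp (s * (-(W ω - m)))) ∂μ) ∧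
          ENNReal.log (∫⁻ ω, ENNReal.ofReal (Real.exp (s * (-(W ω - m)))) ∂μ)
              ≤ ((s^2 / 2 * σ2 + s^3 * d : ℝ) : EReal)) →
        μ {ω | W ω - m ≤ -ε}
            ≤ ENNReal.ofReal (Real.exp (-ε^2 / (2 * (σ2 + 2 * d * ε / σ2))))) := by
  intro ε hε
  refine ⟨measure_ge_le_of_log_laplace_le μ (hWmeas.sub_const m) hσpos hd hε
    fun s hs => (hbound s hs).2, fun hneg => ?_⟩
  have hset : {ω | W ω - m ≤ -ε} = {ω | ε ≤ -(W ω - m)} := by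
    ext ω
    exact le_neg (a := W ω - m) (b := ε)
  rw [hset]
  exact measure_ge_le_of_log_laplace_le μ (hWmeas.sub_const m).neg hσpos hd hε
    fun s hs => (hneg s hs).2
end
end

section
/- Let G be a fixed graph without isolated vertices with k ≥ 2 edges and l ≥ 3 vertices, automorphism group of order a, and let Z = (W − E[W]) / c_{n,p} be the standardized subgraph count, where c_{n,p} = C(n-2,l-2) (2k/a) (l-2)! √( C(n,2) p(1-p) ) p^{k-1}. Then for every i ∈ {1,...,C(n,2)} and all values of the edge variables (x_1,...,x_{C(n,2)}) ∈ {0,1}^{C(n,2)} and y_i ∈ {0,1}, the first-order partial difference satisfies |Δ_i Z| ≤ 1 / ( √( C(n,2) p(1-p) ) · p^{k-1} ). -/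
open MeasureTheory ProbabilityTheory Filter Finset

noncomputable section

/-- The edges of the complete graph `K_n`: non-diagonal elements of `Sym2 (Fin n)`. -/
abbrev EdgeIdx (n : ℕ) := {e : Sym2 (Fin n) // ¬ e.IsDiag}

/-- A set `s` of `k` edges of `K_n` forms a copy of the graph `G` (which has no isolated
vertices): there is an injection of the vertices of `G` into `Fin n` carrying the edge set
of `G` exactly onto `s`. -/
def IsCopy {V : Type*} [Fintype V] [DecidableEq V] (G : SimpleGraph V) [DecidableRel G.Adj]
    (n : ℕ) (s : Finset (EdgeIdx n)) : Prop :=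
  ∃ φ : V ↪ Fin n, s.image (fun e => e.1) = G.edgeFinset.image (Sym2.map φ)

/-- The subgraph count `W` as a function of the vector `x` of edge indicators:
`W = ∑_{κ₁<⋯<κ_k} 1{(e_{κ₁},…,e_{κ_k}) ≅ G} ∏ᵢ x_{κᵢ}`. -/
def subCount {V : Type*} [Fintype V] [DecidableEq V] (G : SimpleGraph V) [DecidableRel G.Adj]
    (n : ℕ) (x : EdgeIdx n → ℝ) : ℝ :=
  letI := Classical.decPred (IsCopy G n)
  ∑ s ∈ (Finset.univ.powersetCard G.edgeFinset.card).filter (IsCopy G n), ∏ e ∈ s, x e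

/-- Embeddings with two prescribed values are at most as many as the embeddings of the
remaining points. -/
lemma card_embedding_two_prescribed_le {V W : Type*} [Fintype V] [DecidableEq V]
    [Fintype W] [DecidableEq W] {u v : V} (huv : u ≠ v) {α β : W} (hαβ : α ≠ β) :
    #{φ : V ↪ W | φ u = α ∧ φ v = β}
      ≤ (Fintype.card W - 2).descFactorial (Fintype.card V - 2) := by
  have hV : Fintype.card {w : V // w ∉ ({u, v} : Finset V)} = Fintype.card V - 2 := by
    rw [Fintype.card_subtype_compl, Fintype.card_coe, card_pair huv]
  have hW : Fintype.card {w : W // w ∉ ({α, β} : Finset W)} = Fintype.card W - 2 := by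
    rw [Fintype.card_subtype_compl, Fintype.card_coe, card_pair hαβ]
  rw [← hV, ← hW, ← Fintype.card_embedding_eq, ← Fintype.card_subtype]
  let restrict (φ : {φ : V ↪ W // φ u = α ∧ φ v = β}) :
      {w : V // w ∉ ({u, v} : Finset V)} ↪ {w : W // w ∉ ({α, β} : Finset W)} :=
    ⟨fun w => ⟨φ.1 w.1, by
        have hw := w.2
        simp only [mem_insert, mem_singleton, not_or] at hw ⊢
        exact ⟨fun h => hw.1 (φ.1.injective (h.trans φ.2.1.symm)),
          fun h => hw.2 (φ.1.injective (h.trans φ.2.2.symm))⟩⟩,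
      fun w w' h => Subtype.ext (φ.1.injective (congrArg Subtype.val h))⟩
  refine Fintype.card_le_of_injective restrict fun φ ψ h => ?_
  ext w
  by_cases hu : w = u
  · rw [hu, φ.2.1, ψ.2.1]
  by_cases hv : w = v
  · rw [hv, φ.2.2, ψ.2.2]
  · exact congrArg Subtype.val (DFunLike.congr_fun h ⟨w, by simp [hu, hv]⟩)

section Copies

variable {V : Type*} [Fintype V] [DecidableEq V] (G : SimpleGraph V) [DecidableRel G.Adj]

/-- At most `2 |E(G)| (n - 2)_{|V| - 2}` embeddings of the vertices of `G` map an edge of `G` to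
a given edge of `K_n`. -/
lemma card_embedding_covering_edge_le (n : ℕ) (i : EdgeIdx n) :
    #{φ : V ↪ Fin n | i.1 ∈ G.edgeFinset.image (Sym2.map φ)}
      ≤ 2 * #G.edgeFinset * (n - 2).descFactorial (Fintype.card V - 2) := by
  obtain ⟨e, he⟩ := i
  induction e with | _ α β
  have hαβ : α ≠ β := by simpa using he
  have hsub : ({φ : V ↪ Fin n | s(α, β) ∈ G.edgeFinset.image (Sym2.map φ)} : Finset _) ⊆
      (univ : Finset G.Dart).biUnion fun d =>
        {φ : V ↪ Fin n | φ d.fst = α ∧ φ d.snd = β} := by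
    intro φ hφ
    simp only [mem_filter, mem_univ, true_and, mem_image] at hφ
    obtain ⟨e, heG, heq⟩ := hφ
    induction e with | _ u v
    have huv : G.Adj u v := by simpa using heG
    simp only [mem_biUnion, mem_univ, true_and, mem_filter]
    rw [Sym2.map_mk, Sym2.eq_iff] at heq
    rcases heq with h | h
    · exact ⟨⟨(u, v), huv⟩, h⟩
    · exact ⟨⟨(v, u), huv.symm⟩, h.2, h.1⟩
  refine (card_le_card hsub).trans (card_biUnion_le.trans ?_)
  rw [← G.dart_card_eq_twice_card_edges, ← card_univ, ← smul_eq_mul]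
  refine sum_le_card_nsmul _ _ _ fun d _ => ?_
  simpa using card_embedding_two_prescribed_le (V := V) d.adj.ne hαβ

lemma image_edgeFinset_map_comp_iso {W : Type*} [DecidableEq W] (f : V → W) (σ : G ≃g G) :
    G.edgeFinset.image (Sym2.map (f ∘ σ)) = G.edgeFinset.image (Sym2.map f) := by
  have h : G.edgeFinset.image (Sym2.map σ) = G.edgeFinset := by
    apply eq_of_subset_of_card_le
    · refine image_subset_iff.2 fun e he => ?_
      induction e with | _ u v
      rw [SimpleGraph.mem_edgeFinset, SimpleGraph.mem_edgeSet] at he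
      rw [Sym2.map_mk, SimpleGraph.mem_edgeFinset, SimpleGraph.mem_edgeSet]
      exact σ.map_rel_iff.2 he
    · rw [card_image_of_injective _ (Sym2.map.injective σ.injective)]
  conv_rhs => rw [← h, image_image, ← Sym2.map_comp]

/-- Every copy of `G` in `K_n` comes from at least `|Aut G|` embeddings. -/
lemma card_aut_mul_card_copies_le (n : ℕ) (i : EdgeIdx n) (S : Finset (Finset (EdgeIdx n)))
    (hS : ∀ s ∈ S, IsCopy G n s ∧ i ∈ s) :
    Nat.card (G ≃g G) * #S ≤ #{φ : V ↪ Fin n | i.1 ∈ G.edgeFinset.image (Sym2.map φ)} := by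
  choose φ hφ using fun s : S => (hS s s.2).1
  have himage (q : (G ≃g G) × S) :
      G.edgeFinset.image (Sym2.map (φ q.2 ∘ q.1)) = q.2.1.image (fun e => e.1) :=
    (image_edgeFinset_map_comp_iso G _ q.1).trans (hφ q.2).symm
  let embed (q : (G ≃g G) × S) :
      ({φ : V ↪ Fin n | i.1 ∈ G.edgeFinset.image (Sym2.map φ)} : Finset _) :=
    ⟨q.1.toEquiv.toEmbedding.trans (φ q.2), by
      rw [mem_filter_univ]
      exact (himage q).symm ▸ mem_image_of_mem _ (hS _ q.2.2).2⟩
  have hinj : Function.Injective embed := by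
    rintro ⟨σ, s⟩ ⟨τ, t⟩ h
    have hfun : φ s ∘ σ = φ t ∘ τ := congrArg (fun ψ => (ψ.1 : V → Fin n)) h
    have hst : s = t := Subtype.ext <| image_injective Subtype.val_injective <| by
      rw [← himage (σ, s), ← himage (τ, t)]
      simp only [hfun]
    subst hst
    have hστ : σ = τ := by
      ext w
      exact (φ s).injective (congrFun hfun w)
    rw [hστ]
  have hcard := Nat.card_le_card_of_injective embed hinj
  rwa [Nat.card_prod, Nat.card_eq_finsetCard, Nat.card_eq_finsetCard] at hcard

/-- Changing one edge indicator changes the subgraph count by at most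
`2 |E(G)| (n - 2)_{|V| - 2} / |Aut G|`. -/
lemma card_aut_mul_abs_subCount_sub_update_le (n : ℕ) (i : EdgeIdx n) (x : EdgeIdx n → ℝ) (y : ℝ)
    (hx : ∀ e, x e = 0 ∨ x e = 1) (hy : y = 0 ∨ y = 1) :
    Nat.card (G ≃g G) * |subCount G n x - subCount G n (Function.update x i y)|
      ≤ 2 * #G.edgeFinset * (n - 2).descFactorial (Fintype.card V - 2) := by
  classical
  set T := (univ.powersetCard #G.edgeFinset).filter (IsCopy G n) with hT
  have hcount (z : EdgeIdx n → ℝ) : subCount G n z = ∑ s ∈ T, ∏ e ∈ s, z e := by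
    unfold subCount
    congr!
  have hprod (z : EdgeIdx n → ℝ) (hz : ∀ e, z e = 0 ∨ z e = 1) (s : Finset (EdgeIdx n)) :
      0 ≤ ∏ e ∈ s, z e ∧ ∏ e ∈ s, z e ≤ 1 := by
    have hz' (e) : 0 ≤ z e ∧ z e ≤ 1 := by rcases hz e with h | h <;> simp [h]
    exact ⟨prod_nonneg fun e _ => (hz' e).1,
      prod_le_one (fun e _ => (hz' e).1) fun e _ => (hz' e).2⟩
  have hx' (e) : Function.update x i y e = 0 ∨ Function.update x i y e = 1 := by
    by_cases h : e = i
    · simpa [h] using hy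
    · simpa [h] using hx e
  have hdiff : |subCount G n x - subCount G n (Function.update x i y)|
      ≤ #(T.filter (i ∈ ·)) := by
    rw [hcount, hcount, ← sum_sub_distrib, card_filter, Nat.cast_sum]
    refine (abs_sum_le_sum_abs _ _).trans (sum_le_sum fun s _ => ?_)
    split_ifs with his
    · have h₁ := hprod x hx s
      have h₂ := hprod _ hx' s
      rw [abs_le]
      push_cast
      constructor <;> linarith
    · simp [prod_update_of_notMem his]
  have hcard := (card_aut_mul_card_copies_le G n i (T.filter (i ∈ ·)) fun s hs => by
    simp only [hT, mem_filter] at hs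
    exact ⟨hs.1.2, hs.2⟩).trans (card_embedding_covering_edge_le G n i)
  calc _ ≤ (Nat.card (G ≃g G) : ℝ) * #(T.filter (i ∈ ·)) := by gcongr
    _ ≤ _ := by exact_mod_cast hcard

end Copies


/-- **First-order partial difference bound for the standardized subgraph count**
(inequality (13) in Lemma 5.1 of Döring–Eichelsbacher): for the standardized subgraph
count `Z = (W − E W)/c_{n,p}`, each first-order partial difference in an edge variable is
bounded by `1/(√(C(n,2) p(1−p)) p^{k−1})`. -/
theorem subgraph_first_order_difference_bound
    {V : Type} [Fintype V] [DecidableEq V] (G : SimpleGraph V) [DecidableRel G.Adj]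
    (k l a : ℕ) (hkdef : G.edgeFinset.card = k) (hldef : Fintype.card V = l)
    (hk : 2 ≤ k) (hl : 3 ≤ l) (hnoiso : ∀ v : V, ∃ w, G.Adj v w)
    (ha : Nat.card (G ≃g G) = a)
    (n : ℕ) (p : ℝ) (hp0 : 0 < p) (hp1 : p < 1)
    (c : ℝ)
    (hc : c = ((n-2).choose (l-2) : ℝ) * (2 * k / (a : ℝ)) * ((l-2).factorial : ℝ)
      * Real.sqrt ((n.choose 2 : ℝ) * p * (1 - p)) * p ^ (k-1))
    (EW : ℝ) (hEW : EW = ((n.choose l : ℝ) * (l.factorial : ℝ) / (a : ℝ)) * p ^ k)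
    (Z : (EdgeIdx n → ℝ) → ℝ)
    (hZ : ∀ x, Z x = (subCount G n x - EW) / c) :
    ∀ (i : EdgeIdx n) (x : EdgeIdx n → ℝ) (y : ℝ),
      (∀ e, x e = 0 ∨ x e = 1) → (y = 0 ∨ y = 1) →
      |Z x - Z (Function.update x i y)|
        ≤ 1 / (Real.sqrt ((n.choose 2 : ℝ) * p * (1 - p)) * p ^ (k-1)) := by
  intro i x y hx hy
  have hbound := card_aut_mul_abs_subCount_sub_update_le G n i x y hx hy
  rw [ha, hkdef, hldef, Nat.descFactorial_eq_factorial_mul_choose] at hbound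
  have ha0 : 0 < (a : ℝ) := by
    have : Finite (G ≃g G) := Finite.of_injective (fun σ => ⇑σ) DFunLike.coe_injective
    rw [← ha]
    exact_mod_cast Nat.card_pos
  set D := subCount G n x - subCount G n (Function.update x i y)
  set r := Real.sqrt ((n.choose 2 : ℝ) * p * (1 - p)) * p ^ (k-1) with hr
  set M := ((n-2).choose (l-2) : ℝ) * (2 * k / (a : ℝ)) * ((l-2).factorial : ℝ) with hM
  have hr0 : 0 ≤ r := by positivity
  have hM0 : 0 ≤ M := by positivity
  have hD : |D| ≤ M := by
    have haM : a * M = 2 * k * ((l-2).factorial * (n-2).choose (l-2)) := by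
      rw [hM]
      field_simp
    refine le_of_mul_le_mul_left ?_ ha0
    rw [haM]
    exact_mod_cast hbound
  have hcM : c = M * r := by rw [hc, hr, mul_assoc]
  rw [hZ, hZ, ← sub_div, sub_sub_sub_cancel_right, abs_div, hcM, abs_of_nonneg (mul_nonneg hM0 hr0),
    ← div_div]
  gcongr
  exact div_le_one_of_le₀ hD hM0
end
end

section
/- Let h : 𝒳² → ℝ be a bounded symmetric kernel and let f(x_1,...,x_n) = √n · (1/C(n,2)) Σ_{1≤i<j≤n} h(x_i,x_j). Then for all k < m in {1,...,n}, all x_1,...,x_n ∈ 𝒳 and y_k, y_m ∈ 𝒳, the second-order partial difference satisfies Δ_m Δ_k f(x_1^n; y_k, y_m) = 2 ( h(x_k,x_m) − h(y_k,x_m) − h(x_k,y_m) + h(y_k,y_m) ) / ( √n (n-1) ), and hence |Δ_m Δ_k f(x_1^n; y_k, y_m)| ≤ 16 ‖h‖_∞ / n^{3/2}. -/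
open Finset

noncomputable section

/-- The scaled U-statistic of degree 2: `f(x₁,…,xₙ) = √n (1/C(n,2)) ∑_{i<j} h(xᵢ,xⱼ)`. -/
def scaledUStat {𝒳 : Type*} (n : ℕ) (h : 𝒳 → 𝒳 → ℝ) (x : Fin n → 𝒳) : ℝ :=
  Real.sqrt n * ((n.choose 2 : ℝ))⁻¹ *
    ∑ j : Fin n, ∑ i ∈ Finset.univ.filter (fun i => i < j), h (x i) (x j)

/-- `‖h‖_∞ = sup_{x,y} |h(x,y)|`. -/
def kernelSup {𝒳 : Type*} (h : 𝒳 → 𝒳 → ℝ) : ℝ :=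
  sSup {r : ℝ | ∃ x y, r = |h x y|}

/-- The second-order difference, in the coordinates `k < m`, of a sum over pairs `i < j` only sees
the term of the pair `(k, m)`. -/
theorem sum_pairs_second_difference {ι 𝒳 : Type*} [Fintype ι] [LinearOrder ι]
    (h : 𝒳 → 𝒳 → ℝ) {k m : ι} (hkm : k < m) (x : ι → 𝒳) (yk ym : 𝒳) :
    (∑ j, ∑ i with i < j, h (x i) (x j))
        - (∑ j, ∑ i with i < j, h (Function.update x m ym i) (Function.update x m ym j))
        - (∑ j, ∑ i with i < j, h (Function.update x k yk i) (Function.update x k yk j))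
        + (∑ j, ∑ i with i < j, h (Function.update (Function.update x k yk) m ym i)
            (Function.update (Function.update x k yk) m ym j))
      = h (x k) (x m) - h yk (x m) - h (x k) ym + h yk ym := by
  simp only [← sum_sub_distrib, ← sum_add_distrib]
  rw [sum_eq_single m, sum_eq_single k]
  · simp [hkm.ne, hkm.ne']
    ring
  · intro i hi hik
    have him : i ≠ m := (mem_filter.1 hi).2.ne
    simp [hik, him, hkm.ne']
  · simp [hkm]
  · intro j _ hjm
    refine sum_eq_zero fun i hi => ?_
    have hij : i < j := (mem_filter.1 hi).2
    by_cases hjk : j = k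
    · subst hjk
      simp [hij.ne, (hij.trans hkm).ne, hjm]
    · by_cases him : i = m
      · subst him
        simp [hjm, hjk, hkm.ne']
      · simp [hjm, hjk, him]
  · simp

theorem abs_le_kernelSup {𝒳 : Type*} {h : 𝒳 → 𝒳 → ℝ}
    (hbdd : BddAbove {r : ℝ | ∃ x y, r = |h x y|}) (x y : 𝒳) : |h x y| ≤ kernelSup h :=
  le_csSup hbdd ⟨x, y, rfl⟩

theorem sqrt_mul_inv_choose_two {n : ℕ} (hn : 2 ≤ n) :
    Real.sqrt n * ((n.choose 2 : ℝ))⁻¹ = 2 / (Real.sqrt n * ((n : ℝ) - 1)) := by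
  have hn' : (2 : ℝ) ≤ n := by exact_mod_cast hn
  have h1 : (n : ℝ) - 1 ≠ 0 := by linarith
  have hs : Real.sqrt n ≠ 0 := (Real.sqrt_pos.2 (by linarith)).ne'
  have hsq : Real.sqrt n ^ 2 = n := Real.sq_sqrt (by linarith)
  have h0 : (n : ℝ) ≠ 0 := by linarith
  rw [Nat.cast_choose_two]
  field_simp
  exact hsq


/-- **Second-order partial difference of a degree-2 U-statistic**: for `k < m`,
`Δₘ Δₖ f(x; yₖ, yₘ) = 2(h(xₖ,xₘ) − h(yₖ,xₘ) − h(xₖ,yₘ) + h(yₖ,yₘ))/(√n (n−1))`, and hence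
`|Δₘ Δₖ f(x; yₖ, yₘ)| ≤ 16 ‖h‖_∞ / n^{3/2}`. -/
theorem ustat_second_order_difference
    {𝒳 : Type} (n : ℕ) (h : 𝒳 → 𝒳 → ℝ)
    (hbdd : BddAbove {r : ℝ | ∃ x y, r = |h x y|})
    (hsymm : ∀ x y, h x y = h y x)
    (k m : Fin n) (hkm : k < m) (x : Fin n → 𝒳) (yk ym : 𝒳) :
    scaledUStat n h x - scaledUStat n h (Function.update x m ym)
        - scaledUStat n h (Function.update x k yk)
        + scaledUStat n h (Function.update (Function.update x k yk) m ym)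
      = 2 * (h (x k) (x m) - h yk (x m) - h (x k) ym + h yk ym)
          / (Real.sqrt n * ((n : ℝ) - 1))
    ∧ |scaledUStat n h x - scaledUStat n h (Function.update x m ym)
        - scaledUStat n h (Function.update x k yk)
        + scaledUStat n h (Function.update (Function.update x k yk) m ym)|
      ≤ 16 * kernelSup h / (n : ℝ) ^ ((3 : ℝ)/2) := by
  have hn : 2 ≤ n := by
    have := m.isLt
    have : (k : ℕ) < m := hkm
    omega
  have hn' : (2 : ℝ) ≤ n := by exact_mod_cast hn
  have key : scaledUStat n h x - scaledUStat n h (Function.update x m ym)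
        - scaledUStat n h (Function.update x k yk)
        + scaledUStat n h (Function.update (Function.update x k yk) m ym)
      = 2 * (h (x k) (x m) - h yk (x m) - h (x k) ym + h yk ym)
          / (Real.sqrt n * ((n : ℝ) - 1)) := by
    simp only [scaledUStat]
    rw [← mul_sub, ← mul_sub, ← mul_add, sum_pairs_second_difference h hkm,
      sqrt_mul_inv_choose_two hn, div_mul_eq_mul_div]
  refine ⟨key, ?_⟩
  have hs : 0 < Real.sqrt n := Real.sqrt_pos.2 (by linarith)
  have hpow : (n : ℝ) ^ ((3 : ℝ) / 2) = n * Real.sqrt n := by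
    rw [Real.sqrt_eq_rpow, ← Real.rpow_one_add' (by positivity) (by norm_num)]
    norm_num
  have hD : |h (x k) (x m) - h yk (x m) - h (x k) ym + h yk ym| ≤ 4 * kernelSup h := by
    have h1 := abs_le.1 (abs_le_kernelSup hbdd (x k) (x m))
    have h2 := abs_le.1 (abs_le_kernelSup hbdd yk (x m))
    have h3 := abs_le.1 (abs_le_kernelSup hbdd (x k) ym)
    have h4 := abs_le.1 (abs_le_kernelSup hbdd yk ym)
    rw [abs_le]
    constructor <;> linarith
  have hK : 0 ≤ kernelSup h := (abs_nonneg _).trans (abs_le_kernelSup hbdd yk ym)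
  have hden : 0 < Real.sqrt n * ((n : ℝ) - 1) := mul_pos hs (by linarith)
  rw [key, hpow, abs_div, abs_of_pos hden, abs_mul, abs_two]
  calc 2 * |h (x k) (x m) - h yk (x m) - h (x k) ym + h yk ym| / (Real.sqrt n * ((n : ℝ) - 1))
      ≤ 2 * (4 * kernelSup h) / (Real.sqrt n * ((n : ℝ) / 2)) := by
        gcongr
        linarith
    _ = 16 * kernelSup h / (n * Real.sqrt n) := by
        field_simp
        ring
end
end
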